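/- Let n ≥ 1, 0 < α < n, 0 < t < ∞, 1 < p < r < ∞ and 1 < q < s < ∞ satisfy α/n = 1/p − 1/r = 1/q − 1/s. Let Ω be homogeneous of degree zero, have mean value zero on S^{n−1}, and suppose in addition that Ω is infinitely differentiable on an open subset of S^{n−1} on which it has no zeros. If b is locally integrable and the commutator [b, T_{Ω,α}] is bounded from (E_p^q)_t(ℝ^n) to (E_r^s)_t(ℝ^n), i.e. there is C₀ with ‖[b, T_{Ω,α}]f‖_{(E_r^s)_t} ≤ C₀ ‖f‖_{(E_p^q)_t} for all f ∈ (E_p^q)_t(ℝ^n), then b ∈ BMO(ℝ^n), with ‖b‖_{BMO} ≤ C C₀ for a constant C independent of b. -/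

import Mathlib

open MeasureTheory ENNReal Metric

noncomputable section

/-- The (closed) cube centered at `x` with side length `r`. -/
def cube {n : ℕ} (x : EuclideanSpace ℝ (Fin n)) (r : ℝ) : Set (EuclideanSpace ℝ (Fin n)) :=
  {y | ∀ i, |y i - x i| ≤ r / 2}

/-- The average `f_Q = |Q|⁻¹ ∫_Q f` of `f` over a set `Q`. -/
def setAvg {n : ℕ} (Q : Set (EuclideanSpace ℝ (Fin n))) (f : EuclideanSpace ℝ (Fin n) → ℝ) : ℝ :=
  (volume Q).toReal⁻¹ * ∫ y in Q, f y

/-- Slice norm of an `ℝ≥0∞`-valued function. -/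
def sliceNormE {n : ℕ} (p q t : ℝ) (g : EuclideanSpace ℝ (Fin n) → ℝ≥0∞) : ℝ≥0∞ :=
  (∫⁻ x, ((volume (cube x t))⁻¹ * ∫⁻ y in cube x t, g y ^ p) ^ (q / p)) ^ (1 / q)

/-- The slice space norm `‖f‖_{(E_p^q)_t}`. -/
def sliceNorm {n : ℕ} (p q t : ℝ) (f : EuclideanSpace ℝ (Fin n) → ℝ) : ℝ≥0∞ :=
  sliceNormE p q t fun y => ENNReal.ofReal |f y|

/-- Membership in the slice space `(E_p^q)_t(ℝⁿ)`. -/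
def MemSlice {n : ℕ} (p q t : ℝ) (f : EuclideanSpace ℝ (Fin n) → ℝ) : Prop :=
  Measurable f ∧ sliceNorm p q t f ≠ ∞

/-- The BMO seminorm, as a supremum over all cubes. -/
def bmoNorm {n : ℕ} (b : EuclideanSpace ℝ (Fin n) → ℝ) : ℝ≥0∞ :=
  ⨆ (x : EuclideanSpace ℝ (Fin n)) (r : ℝ) (_ : 0 < r),
    (volume (cube x r))⁻¹ * ∫⁻ y in cube x r, ENNReal.ofReal |b y - setAvg (cube x r) b|

/-- Membership in `BMO(ℝⁿ)`. -/
def MemBMO {n : ℕ} (b : EuclideanSpace ℝ (Fin n) → ℝ) : Prop :=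
  LocallyIntegrable b volume ∧ bmoNorm b ≠ ∞

/-- `Ω` is homogeneous of degree zero. -/
def HomogZero {n : ℕ} (Ω : EuclideanSpace ℝ (Fin n) → ℝ) : Prop :=
  ∀ lam : ℝ, 0 < lam → ∀ x : EuclideanSpace ℝ (Fin n), x ≠ 0 → Ω (lam • x) = Ω x

/-- `Ω` has mean value zero on the unit sphere. -/
def MeanZeroOnSphere {n : ℕ} (Ω : EuclideanSpace ℝ (Fin n) → ℝ) : Prop :=
  ∫ x : sphere (0 : EuclideanSpace ℝ (Fin n)) 1, Ω x
    ∂((volume : Measure (EuclideanSpace ℝ (Fin n))).toSphere) = 0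

/-- The fractional integral operator with rough kernel,
`T_{Ω,α} f (x) = ∫ Ω(x-y) |x-y|^{α-n} f(y) dy`. -/
def fracInt {n : ℕ} (Ω : EuclideanSpace ℝ (Fin n) → ℝ) (α : ℝ)
    (f : EuclideanSpace ℝ (Fin n) → ℝ) (x : EuclideanSpace ℝ (Fin n)) : ℝ :=
  ∫ y, Ω (x - y) * ‖x - y‖ ^ (α - n) * f y

/-- The commutator `[b, T_{Ω,α}] f = b ⬝ T_{Ω,α} f - T_{Ω,α}(b f)`. -/
def commutatorOp {n : ℕ} (Ω : EuclideanSpace ℝ (Fin n) → ℝ) (α : ℝ)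
    (b f : EuclideanSpace ℝ (Fin n) → ℝ) : EuclideanSpace ℝ (Fin n) → ℝ :=
  fun x => b x * fracInt Ω α f x - fracInt Ω α (fun y => b y * f y) x

/-- The fractional maximal operator `M_γ` (over cubes); `γ = 0` gives the
Hardy–Littlewood maximal operator. -/
def fracMax {n : ℕ} (γ : ℝ) (f : EuclideanSpace ℝ (Fin n) → ℝ)
    (x : EuclideanSpace ℝ (Fin n)) : ℝ≥0∞ :=
  ⨆ (z : EuclideanSpace ℝ (Fin n)) (r : ℝ) (_ : 0 < r) (_ : x ∈ cube z r),
    volume (cube z r) ^ (γ / n - 1) * ∫⁻ y in cube z r, ENNReal.ofReal |f y|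

/-- The Fefferman–Stein sharp maximal operator `M^♯`. -/
def sharpMax {n : ℕ} (f : EuclideanSpace ℝ (Fin n) → ℝ)
    (x : EuclideanSpace ℝ (Fin n)) : ℝ≥0∞ :=
  ⨆ (z : EuclideanSpace ℝ (Fin n)) (r : ℝ) (_ : 0 < r) (_ : x ∈ cube z r),
    (volume (cube z r))⁻¹ * ∫⁻ y in cube z r, ENNReal.ofReal |f y - setAvg (cube z r) f|

/-- The `L^p` norm. -/
def lpNorm {n : ℕ} (p : ℝ) (f : EuclideanSpace ℝ (Fin n) → ℝ) : ℝ≥0∞ :=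
  (∫⁻ x, ENNReal.ofReal |f x| ^ p) ^ (1 / p)

/-- The set of admissible Hölder–Lipschitz constants of order `β` for `b`. -/
def LipConstSet {n : ℕ} (β : ℝ) (b : EuclideanSpace ℝ (Fin n) → ℝ) : Set ℝ :=
  {C : ℝ | ∀ x y, |b x - b y| ≤ C * dist x y ^ β}

/-- Membership in the Lipschitz space `Lip_β(ℝⁿ)`. -/
def MemLip {n : ℕ} (β : ℝ) (b : EuclideanSpace ℝ (Fin n) → ℝ) : Prop :=
  (LipConstSet β b).Nonempty

/-- The `Lip_β` norm: the least admissible constant. -/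
def lipNorm {n : ℕ} (β : ℝ) (b : EuclideanSpace ℝ (Fin n) → ℝ) : ℝ :=
  sInf (LipConstSet β b)

section

open Set Filter Topology

variable {n : ℕ}

lemma cube_eq_preimage (x : EuclideanSpace ℝ (Fin n)) (ρ : ℝ) :
    cube x ρ = (WithLp.ofLp : EuclideanSpace ℝ (Fin n) → Fin n → ℝ) ⁻¹'
      Icc (fun i => x i - ρ / 2) (fun i => x i + ρ / 2) := by
  ext y
  simp only [cube, mem_ofPred_eq, mem_preimage, mem_Icc, Pi.le_def, abs_le, ← forall_and]
  exact forall_congr' fun i => ⟨fun h => ⟨by linarith [h.1], by linarith [h.2]⟩,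
    fun h => ⟨by linarith [h.1], by linarith [h.2]⟩⟩

lemma measurableSet_cube (x : EuclideanSpace ℝ (Fin n)) (ρ : ℝ) : MeasurableSet (cube x ρ) := by
  rw [cube_eq_preimage]
  exact (PiLp.volume_preserving_ofLp (Fin n)).measurable measurableSet_Icc

lemma volume_cube (x : EuclideanSpace ℝ (Fin n)) {ρ : ℝ} (hρ : 0 ≤ ρ) :
    volume (cube x ρ) = ENNReal.ofReal (ρ ^ n) := by
  rw [cube_eq_preimage, (PiLp.volume_preserving_ofLp (Fin n)).measure_preimage
    measurableSet_Icc.nullMeasurableSet, Real.volume_Icc_pi]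
  have : ∀ i : Fin n, x i + ρ / 2 - (x i - ρ / 2) = ρ := fun i => by ring
  simp only [this, Finset.prod_const, Finset.card_univ, Fintype.card_fin]
  rw [ENNReal.ofReal_pow hρ]

lemma mem_cube_comm {x y : EuclideanSpace ℝ (Fin n)} {ρ : ℝ} : y ∈ cube x ρ ↔ x ∈ cube y ρ := by
  simp only [cube, mem_ofPred_eq, abs_sub_comm]

lemma mem_cube_add {x y z : EuclideanSpace ℝ (Fin n)} {ρ τ : ℝ} (hx : y ∈ cube x ρ)
    (hz : z ∈ cube y τ) : z ∈ cube x (ρ + τ) := fun i => by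
  have h₁ := abs_le.1 (hx i)
  have h₂ := abs_le.1 (hz i)
  exact abs_le.2 ⟨by linarith [h₁.1, h₂.1], by linarith [h₁.2, h₂.2]⟩

lemma cube_mono (x : EuclideanSpace ℝ (Fin n)) {ρ τ : ℝ} (h : ρ ≤ τ) : cube x ρ ⊆ cube x τ :=
  fun _ hy i => (hy i).trans (by linarith)

lemma cube_subset_closedBall (x : EuclideanSpace ℝ (Fin n)) {ρ : ℝ} (hρ : 0 ≤ ρ) :
    cube x ρ ⊆ closedBall x (n * ρ) := by
  intro y hy
  rw [mem_closedBall, dist_eq_norm, EuclideanSpace.norm_eq]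
  refine Real.sqrt_le_iff.2 ⟨by positivity, ?_⟩
  calc ∑ i, ‖(y - x) i‖ ^ 2 ≤ ∑ _i : Fin n, ρ ^ 2 := by
        refine Finset.sum_le_sum fun i _ => pow_le_pow_left₀ (norm_nonneg _) ?_ 2
        exact (hy i).trans (by linarith)
    _ = n * ρ ^ 2 := by simp
    _ ≤ (n * ρ) ^ 2 := by
        rw [mul_pow]
        refine mul_le_mul_of_nonneg_right ?_ (by positivity)
        exact_mod_cast Nat.le_self_pow two_ne_zero n

lemma measurableSet_mem_cube (t : ℝ) :
    MeasurableSet {z : EuclideanSpace ℝ (Fin n) × EuclideanSpace ℝ (Fin n) |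
      z.2 ∈ cube z.1 t} := by
  have h : IsClosed {z : EuclideanSpace ℝ (Fin n) × EuclideanSpace ℝ (Fin n) |
      z.2 ∈ cube z.1 t} := by
    have h' : {z : EuclideanSpace ℝ (Fin n) × EuclideanSpace ℝ (Fin n) | z.2 ∈ cube z.1 t} =
        ⋂ i, {z | |z.2 i - z.1 i| ≤ t / 2} := by
      ext z
      simp [cube]
    rw [h']
    refine isClosed_iInter fun i => isClosed_le (Continuous.abs ?_) continuous_const
    exact ((EuclideanSpace.proj (𝕜 := ℝ) i).continuous.comp continuous_snd).sub
      ((EuclideanSpace.proj (𝕜 := ℝ) i).continuous.comp continuous_fst)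
  exact h.measurableSet

lemma sliceNormE_mono {p q t : ℝ} (hp : 0 < p) (hq : 0 < q)
    {g h : EuclideanSpace ℝ (Fin n) → ℝ≥0∞} (hgh : ∀ x, g x ≤ h x) :
    sliceNormE p q t g ≤ sliceNormE p q t h := by
  unfold sliceNormE
  gcongr
  exact hgh _

lemma measurable_lintegral_cube (t : ℝ) {g : EuclideanSpace ℝ (Fin n) → ℝ≥0∞}
    (hg : Measurable g) : Measurable fun x => ∫⁻ y in cube x t, g y := by
  have h : Measurable fun z : EuclideanSpace ℝ (Fin n) × EuclideanSpace ℝ (Fin n) =>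
      {z : EuclideanSpace ℝ (Fin n) × EuclideanSpace ℝ (Fin n) | z.2 ∈ cube z.1 t}.indicator
        (fun z => g z.2) z :=
    (hg.comp measurable_snd).indicator (measurableSet_mem_cube t)
  convert h.lintegral_prod_right' (ν := volume) using 2 with x
  rw [← lintegral_indicator (measurableSet_cube x t)]
  rfl

/-- Averaging over cubes of fixed side length preserves the integral. -/
lemma lintegral_average_cube {t : ℝ} (ht : 0 < t) {g : EuclideanSpace ℝ (Fin n) → ℝ≥0∞}
    (hg : Measurable g) :
    ∫⁻ x, (volume (cube x t))⁻¹ * ∫⁻ y in cube x t, g y = ∫⁻ y, g y := by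
  have hc : ENNReal.ofReal (t ^ n) ≠ 0 := by simpa using pow_pos ht n
  simp only [volume_cube _ ht.le]
  rw [lintegral_const_mul _ (measurable_lintegral_cube t hg)]
  have h : Measurable fun z : EuclideanSpace ℝ (Fin n) × EuclideanSpace ℝ (Fin n) =>
      {z : EuclideanSpace ℝ (Fin n) × EuclideanSpace ℝ (Fin n) | z.2 ∈ cube z.1 t}.indicator
        (fun z => g z.2) z :=
    (hg.comp measurable_snd).indicator (measurableSet_mem_cube t)
  have h₁ : ∀ x, ∫⁻ y in cube x t, g y = ∫⁻ y, {z : EuclideanSpace ℝ (Fin n) ×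
      EuclideanSpace ℝ (Fin n) | z.2 ∈ cube z.1 t}.indicator (fun z => g z.2) (x, y) := by
    intro x
    rw [← lintegral_indicator (measurableSet_cube x t)]
    rfl
  simp only [h₁]
  rw [lintegral_lintegral_swap (f := fun x y => {z : EuclideanSpace ℝ (Fin n) ×
      EuclideanSpace ℝ (Fin n) | z.2 ∈ cube z.1 t}.indicator (fun z => g z.2) (x, y))
      h.aemeasurable]
  have h₂ : ∀ y, ∫⁻ x, {z : EuclideanSpace ℝ (Fin n) × EuclideanSpace ℝ (Fin n) |
      z.2 ∈ cube z.1 t}.indicator (fun z => g z.2) (x, y) = g y * ENNReal.ofReal (t ^ n) := by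
    intro y
    rw [← volume_cube y ht.le, ← setLIntegral_const, ← lintegral_indicator (measurableSet_cube y t)]
    refine lintegral_congr fun x => ?_
    by_cases hx : x ∈ cube y t
    · rw [indicator_of_mem hx, indicator_of_mem (show (x, y) ∈ {z : EuclideanSpace ℝ (Fin n) ×
        EuclideanSpace ℝ (Fin n) | z.2 ∈ cube z.1 t} from mem_cube_comm.1 hx)]
    · rw [indicator_of_notMem hx, indicator_of_notMem (show (x, y) ∉ {z : EuclideanSpace ℝ (Fin n) ×
        EuclideanSpace ℝ (Fin n) | z.2 ∈ cube z.1 t} from fun h' => hx (mem_cube_comm.1 h'))]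
  simp only [h₂]
  rw [lintegral_mul_const _ hg, mul_comm (∫⁻ y, g y), ← mul_assoc,
    ENNReal.inv_mul_cancel hc ofReal_ne_top, one_mul]

/-- The Hölder inequality for slice norms. -/
lemma lintegral_mul_le_sliceNormE {t r s r' s' : ℝ} (ht : 0 < t) (hr : r.HolderConjugate r')
    (hs : s.HolderConjugate s') {g h : EuclideanSpace ℝ (Fin n) → ℝ≥0∞}
    (hg : Measurable g) (hh : Measurable h) :
    ∫⁻ y, g y * h y ≤ sliceNormE r s t g * sliceNormE r' s' t h := by
  rw [← lintegral_average_cube ht (g := fun y => g y * h y) (hg.mul hh)]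
  have key : ∀ (x : EuclideanSpace ℝ (Fin n)),
      (volume (cube x t))⁻¹ * ∫⁻ y in cube x t, g y * h y ≤
        ((volume (cube x t))⁻¹ * ∫⁻ y in cube x t, g y ^ r) ^ (1 / r) *
        ((volume (cube x t))⁻¹ * ∫⁻ y in cube x t, h y ^ r') ^ (1 / r') := by
    intro x
    have hr0 : 0 ≤ 1 / r := (one_div_pos.2 hr.pos).le
    have hr0' : 0 ≤ 1 / r' := (one_div_pos.2 hr.symm.pos).le
    rw [ENNReal.mul_rpow_of_nonneg _ _ hr0, ENNReal.mul_rpow_of_nonneg _ _ hr0',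
      mul_mul_mul_comm, ← ENNReal.rpow_add_of_nonneg _ _ hr0 hr0', one_div, one_div,
      hr.inv_add_inv_eq_one, ENNReal.rpow_one]
    gcongr
    simpa only [one_div, Pi.mul_apply] using
      ENNReal.lintegral_mul_le_Lp_mul_Lq _ hr hg.aemeasurable hh.aemeasurable
  refine (lintegral_mono key).trans ?_
  have meas : ∀ {f : EuclideanSpace ℝ (Fin n) → ℝ≥0∞} (e : ℝ), Measurable f →
      Measurable fun x => ((volume (cube x t))⁻¹ * ∫⁻ y in cube x t, f y ^ e) ^ (1 / e) := by
    intro f e hf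
    simp only [volume_cube _ ht.le]
    exact ((measurable_lintegral_cube t (hf.pow_const e)).const_mul _).pow_const _
  refine (ENNReal.lintegral_mul_le_Lp_mul_Lq _ hs (meas r hg).aemeasurable
    (meas r' hh).aemeasurable).trans_eq ?_
  simp only [sliceNormE, ← ENNReal.rpow_mul, one_div_mul_eq_div]

/-- The slice norm of the indicator function of a cube of side length `ρ`. -/
lemma sliceNormE_le_of_le_indicator_cube {p q t ρ : ℝ} (hp : 0 < p) (hq : 0 < q) (ht : 0 < t)
    (hρ : 0 < ρ) (z : EuclideanSpace ℝ (Fin n)) {g : EuclideanSpace ℝ (Fin n) → ℝ≥0∞}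
    (hg : ∀ y, g y ≤ (cube z ρ).indicator 1 y) :
    sliceNormE p q t g ≤
      ENNReal.ofReal ((ρ / max ρ t) ^ (n / p) * (2 * max ρ t) ^ (n / q)) := by
  set M := max ρ t with hM
  have hM0 : 0 < M := lt_max_of_lt_left hρ
  have key : ∀ x : EuclideanSpace ℝ (Fin n),
      (volume (cube x t))⁻¹ * ∫⁻ y in cube x t, g y ^ p ≤
        (cube z (2 * M)).indicator (fun _ => ENNReal.ofReal ((ρ / M) ^ n)) x := by
    intro x
    have h₁ : ∫⁻ y in cube x t, g y ^ p ≤ volume (cube z ρ ∩ cube x t) := by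
      rw [← Measure.restrict_apply (measurableSet_cube z ρ),
        ← lintegral_indicator_one (measurableSet_cube z ρ)]
      refine lintegral_mono fun y => ?_
      refine (ENNReal.rpow_le_rpow (hg y) hp.le).trans ?_
      by_cases hy : y ∈ cube z ρ <;> simp [hy, hp]
    by_cases hx : x ∈ cube z (2 * M)
    · rw [indicator_of_mem hx]
      have h₂ : ∫⁻ y in cube x t, g y ^ p ≤ ENNReal.ofReal (min ρ t ^ n) := by
        refine h₁.trans ?_
        rcases le_total ρ t with h | h
        · rw [min_eq_left h, ← volume_cube z hρ.le]
          exact measure_mono inter_subset_left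
        · rw [min_eq_right h, ← volume_cube x ht.le]
          exact measure_mono inter_subset_right
      rw [volume_cube x ht.le, ← ENNReal.ofReal_inv_of_pos (pow_pos ht n)]
      refine (mul_le_mul_right h₂ _).trans_eq ?_
      rw [← ENNReal.ofReal_mul (by positivity), ← inv_pow, ← mul_pow]
      congr 2
      rcases le_total ρ t with h | h
      · rw [hM, min_eq_left h, max_eq_right h]; field_simp
      · rw [hM, min_eq_right h, max_eq_left h]; field_simp
    · have h₂ : cube z ρ ∩ cube x t = ∅ := by
        refine eq_empty_of_forall_notMem fun y hy => hx ?_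
        refine cube_mono z ?_ (mem_cube_add hy.1 (mem_cube_comm.1 hy.2))
        linarith [le_max_left ρ t, le_max_right ρ t]
      rw [h₂, measure_empty, nonpos_iff_eq_zero] at h₁
      simp [h₁]
  have hqp : 0 < q / p := div_pos hq hp
  calc sliceNormE p q t g
      ≤ (∫⁻ x, (cube z (2 * M)).indicator
          (fun _ => ENNReal.ofReal ((ρ / M) ^ n) ^ (q / p)) x) ^ (1 / q) := by
        unfold sliceNormE
        gcongr with x
        refine (ENNReal.rpow_le_rpow (key x) hqp.le).trans_eq ?_
        by_cases hx : x ∈ cube z (2 * M) <;> simp [hx, hqp]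
    _ = ENNReal.ofReal ((ρ / M) ^ (n / p) * (2 * M) ^ (n / q)) := by
        rw [lintegral_indicator (measurableSet_cube _ _), setLIntegral_const,
          volume_cube _ (by positivity), ENNReal.ofReal_rpow_of_nonneg (by positivity) hqp.le,
          ← ENNReal.ofReal_mul (by positivity),
          ENNReal.ofReal_rpow_of_nonneg (by positivity) (by positivity),
          Real.mul_rpow (by positivity) (by positivity), ← Real.rpow_natCast,
          ← Real.rpow_natCast, ← Real.rpow_mul (by positivity), ← Real.rpow_mul (by positivity),
          ← Real.rpow_mul (by positivity)]
        congr 3 <;> field_simp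

/-- Every finite measure on the real line has a median. -/
lemma exists_median (ν : Measure ℝ) [IsFiniteMeasure ν] :
    ∃ m : ℝ, ν univ ≤ 2 * ν (Iic m) ∧ ν univ ≤ 2 * ν (Ici m) := by
  rcases eq_or_ne (ν univ) 0 with h0 | h0
  · exact ⟨0, by simp [h0], by simp [h0]⟩
  have h2 : (2 : ℝ≥0∞) ≠ ∞ := ENNReal.ofNat_ne_top
  set S : Set ℝ := {c | ν univ < 2 * ν (Iic c)}
  have hup : ∀ {a c}, a ∈ S → a ≤ c → c ∈ S := fun ha hac =>
    lt_of_lt_of_le ha (mul_le_mul_right (measure_mono (Iic_subset_Iic.2 hac)) _)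
  have htop : Tendsto (fun c => 2 * ν (Iic c)) atTop (𝓝 (2 * ν univ)) :=
    ENNReal.Tendsto.const_mul (tendsto_measure_Iic_atTop ν) (Or.inr h2)
  have hbot : Tendsto (fun k : ℕ => 2 * ν (Iic (-(k : ℝ)))) atTop (𝓝 (2 * ν ∅)) := by
    refine ENNReal.Tendsto.const_mul ?_ (Or.inr h2)
    have hI : (⋂ k : ℕ, Iic (-(k : ℝ))) = ∅ := by
      refine eq_empty_of_forall_notMem fun x hx => ?_
      obtain ⟨k, hk⟩ := exists_nat_gt (-x)
      have : x ≤ -(k : ℝ) := mem_iInter.1 hx k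
      linarith
    rw [← hI]
    refine tendsto_measure_iInter_atTop (fun k => measurableSet_Iic.nullMeasurableSet) ?_
      ⟨0, measure_ne_top _ _⟩
    intro a c hac
    exact Iic_subset_Iic.2 (by simpa using hac)
  have hlt : ν univ < 2 * ν univ := by
    rw [two_mul]; exact ENNReal.lt_add_right (measure_ne_top _ _) h0
  obtain ⟨a, ha⟩ := (htop.eventually (lt_mem_nhds hlt)).exists
  have hpos : 2 * ν ∅ < ν univ := by simpa using pos_iff_ne_zero.2 h0
  obtain ⟨k, hk⟩ := (hbot.eventually (gt_mem_nhds hpos)).exists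
  have hbdd : BddBelow S := ⟨-(k : ℝ), fun c hc => by
    by_contra! hck
    exact lt_irrefl _ ((hup hc hck.le : _ < _).trans hk)⟩
  refine ⟨sInf S, ?_, ?_⟩
  · have hI : (⋂ k : ℕ, Iic (sInf S + 1 / ((k : ℝ) + 1))) = Iic (sInf S) := by
      ext x
      simp only [mem_iInter, mem_Iic]
      refine ⟨fun h => ?_, fun h k => h.trans (by simp; positivity)⟩
      have := tendsto_one_div_add_atTop_nhds_zero_nat (𝕜 := ℝ)
      exact ge_of_tendsto' (by simpa using this.const_add (sInf S)) h
    have hlim : Tendsto (fun k : ℕ => 2 * ν (Iic (sInf S + 1 / ((k : ℝ) + 1)))) atTop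
        (𝓝 (2 * ν (Iic (sInf S)))) := by
      refine ENNReal.Tendsto.const_mul ?_ (Or.inr h2)
      rw [← hI]
      refine tendsto_measure_iInter_atTop (fun k => measurableSet_Iic.nullMeasurableSet) ?_
        ⟨0, measure_ne_top _ _⟩
      intro a c hac
      refine Iic_subset_Iic.2 ?_
      gcongr
    refine ge_of_tendsto' hlim fun k => ?_
    obtain ⟨c, hc, hck⟩ := exists_lt_of_csInf_lt ⟨a, ha⟩
      (show sInf S < sInf S + 1 / ((k : ℝ) + 1) by simp; positivity)
    exact (hup hc hck.le : _ < _).le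
  · have hU : (⋂ k : ℕ, Ioi (sInf S - 1 / ((k : ℝ) + 1))) = Ici (sInf S) := by
      ext x
      simp only [mem_iInter, mem_Ioi, mem_Ici]
      refine ⟨fun h => ?_, fun h k => lt_of_lt_of_le (by simp; positivity) h⟩
      have := tendsto_one_div_add_atTop_nhds_zero_nat (𝕜 := ℝ)
      exact le_of_tendsto' (by simpa using this.const_sub (sInf S)) fun k => (h k).le
    have hlim : Tendsto (fun k : ℕ => 2 * ν (Ioi (sInf S - 1 / ((k : ℝ) + 1)))) atTop
        (𝓝 (2 * ν (Ici (sInf S)))) := by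
      refine ENNReal.Tendsto.const_mul ?_ (Or.inr h2)
      rw [← hU]
      refine tendsto_measure_iInter_atTop (fun k => measurableSet_Ioi.nullMeasurableSet) ?_
        ⟨0, measure_ne_top _ _⟩
      intro a c hac
      refine Ioi_subset_Ioi ?_
      gcongr
    refine ge_of_tendsto' hlim fun k => ?_
    have hk : sInf S - 1 / ((k : ℝ) + 1) ∉ S := fun h => by
      have := csInf_le hbdd h
      have : (0 : ℝ) < 1 / ((k : ℝ) + 1) := by positivity
      linarith
    have hk' : 2 * ν (Iic (sInf S - 1 / ((k : ℝ) + 1))) ≤ ν univ := not_lt.1 hk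
    have hadd := measure_add_measure_compl (μ := ν)
      (measurableSet_Iic (a := sInf S - 1 / ((k : ℝ) + 1)))
    rw [compl_Iic] at hadd
    have hfin : ν univ ≠ ∞ := measure_ne_top _ _
    refine (ENNReal.add_le_add_iff_left hfin).1 ?_
    calc ν univ + ν univ = 2 * ν (Iic (sInf S - 1 / ((k : ℝ) + 1))) +
          2 * ν (Ioi (sInf S - 1 / ((k : ℝ) + 1))) := by rw [← two_mul, ← mul_add, hadd]
      _ ≤ _ := add_le_add_left hk' _

lemma integrableOn_cube {b : EuclideanSpace ℝ (Fin n) → ℝ} (hb : LocallyIntegrable b volume)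
    (x : EuclideanSpace ℝ (Fin n)) {ρ : ℝ} (hρ : 0 ≤ ρ) : IntegrableOn b (cube x ρ) volume :=
  (hb.integrableOn_isCompact (isCompact_closedBall x (n * ρ))).mono_set (cube_subset_closedBall x hρ)

lemma isFiniteMeasure_restrict_cube (x : EuclideanSpace ℝ (Fin n)) {ρ : ℝ} (hρ : 0 ≤ ρ) :
    IsFiniteMeasure ((volume : Measure (EuclideanSpace ℝ (Fin n))).restrict (cube x ρ)) :=
  isFiniteMeasure_restrict.2 (by rw [volume_cube x hρ]; exact ofReal_ne_top)

/-- The commutator applied to an indicator function, evaluated where the kernel is bounded. -/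
lemma commutatorOp_indicator {Ω k b : EuclideanSpace ℝ (Fin n) → ℝ} {α B : ℝ}
    (hk : Measurable k) (hB : ∀ z, |k z| ≤ B) {E : Set (EuclideanSpace ℝ (Fin n))}
    (hE : MeasurableSet E) (hEfin : volume E ≠ ∞) (hb : IntegrableOn b E volume)
    {x : EuclideanSpace ℝ (Fin n)}
    (hx : ∀ y ∈ E, Ω (x - y) * ‖x - y‖ ^ (α - n) = k (x - y)) :
    IntegrableOn (fun y => k (x - y) * (b x - b y)) E volume ∧
      commutatorOp Ω α b (E.indicator 1) x = ∫ y in E, k (x - y) * (b x - b y) := by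
  have hkm : AEStronglyMeasurable (fun y => k (x - y)) (volume.restrict E) :=
    (hk.comp (measurable_const.sub measurable_id)).aestronglyMeasurable
  have hconst : IntegrableOn (fun _ => b x) E volume := integrableOn_const hEfin
  have h₁ : IntegrableOn (fun y => k (x - y) * b x) E volume :=
    hconst.bdd_mul hkm (Eventually.of_forall fun y => hB (x - y))
  have h₂ : IntegrableOn (fun y => k (x - y) * b y) E volume :=
    Integrable.bdd_mul hb hkm (Eventually.of_forall fun y => hB (x - y))
  refine ⟨(h₁.sub h₂).congr (Eventually.of_forall fun y => (mul_sub _ _ _).symm), ?_⟩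
  have e₁ : fracInt Ω α (E.indicator 1) x = ∫ y in E, k (x - y) := by
    rw [fracInt, ← integral_indicator hE]
    refine integral_congr_ae (Eventually.of_forall fun y => ?_)
    by_cases hy : y ∈ E
    · simp [hy, hx y hy]
    · simp [hy]
  have e₂ : fracInt Ω α (fun y => b y * E.indicator 1 y) x = ∫ y in E, k (x - y) * b y := by
    rw [fracInt, ← integral_indicator hE]
    refine integral_congr_ae (Eventually.of_forall fun y => ?_)
    by_cases hy : y ∈ E
    · simp [hy, hx y hy]
    · simp [hy]
  rw [commutatorOp, e₁, e₂]
  simp only [mul_sub]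
  rw [integral_sub h₁ h₂, integral_mul_const, mul_comm]

/-- On a cube and a suitable translate of it, a rough kernel which is continuous and positive near
some point of the unit sphere agrees with a bounded kernel that is bounded below. -/
lemma exists_bounded_kernel {Ω : EuclideanSpace ℝ (Fin n) → ℝ} (hhom : HomogZero Ω) {α : ℝ}
    (hαn : α < n) {U : Set (EuclideanSpace ℝ (Fin n))} (hU : IsOpen U) (hΩ : ContinuousOn Ω U)
    {w : EuclideanSpace ℝ (Fin n)} (hwU : w ∈ U) (hw : ‖w‖ = 1) (hpos : 0 < Ω w) :
    ∃ (v : EuclideanSpace ℝ (Fin n)) (c : ℝ), 0 < c ∧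
      ∀ (x₀ : EuclideanSpace ℝ (Fin n)) (ρ : ℝ), 0 < ρ →
        ∃ (k : EuclideanSpace ℝ (Fin n) → ℝ) (B : ℝ), Measurable k ∧ (∀ z, |k z| ≤ B) ∧
          ∀ x ∈ cube x₀ ρ, ∀ y ∈ cube (x₀ - ρ • v) ρ,
            Ω (x - y) * ‖x - y‖ ^ (α - n) = k (x - y) ∧ c * ρ ^ (α - n) ≤ k (x - y) := by
  have hexp : α - n ≤ 0 := by linarith
  obtain ⟨δ₀, hδ₀, hball⟩ := Metric.mem_nhds_iff.1 (Filter.inter_mem (hU.mem_nhds hwU)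
    ((hΩ.continuousAt (hU.mem_nhds hwU)) (Ioo_mem_nhds (by linarith : Ω w / 2 < Ω w)
      (by linarith : Ω w < 2 * Ω w))))
  set δ := min δ₀ (1 / 2) with hδdef
  have hδ : 0 < δ := lt_min hδ₀ (by norm_num)
  have hsub : ∀ z ∈ ball w δ, z ∈ U ∧ (Ω w / 2 < Ω z ∧ Ω z < 2 * Ω w) := fun z hz =>
    hball (ball_subset_ball (min_le_left _ _) hz)
  have hnorm : ∀ z ∈ ball w δ, 1 / 2 ≤ ‖z‖ ∧ ‖z‖ ≤ 3 / 2 := by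
    intro z hz
    have h₁ : ‖z - w‖ < 1 / 2 := lt_of_lt_of_le (mem_ball_iff_norm.1 hz) (min_le_right _ _)
    have h₂ := abs_le.1 (abs_norm_sub_norm_le z w)
    constructor <;> linarith [h₂.1, h₂.2]
  set k₀ : EuclideanSpace ℝ (Fin n) → ℝ :=
    (ball w δ).indicator fun z => Ω z * ‖z‖ ^ (α - n) with hk₀
  have hk₀m : Measurable k₀ := by
    classical
    rw [hk₀, ← piecewise_eq_indicator]
    refine ContinuousOn.measurable_piecewise ?_ continuousOn_const isOpen_ball.measurableSet
    refine (hΩ.mono fun z hz => (hsub z hz).1).mul ?_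
    refine ContinuousOn.rpow_const continuous_norm.continuousOn fun z hz => Or.inl ?_
    linarith [(hnorm z hz).1]
  have hk₀B : ∀ z, |k₀ z| ≤ 2 * Ω w * (1 / 2) ^ (α - n) := by
    intro z
    by_cases hz : z ∈ ball w δ
    · obtain ⟨-, h₁, h₂⟩ := hsub z hz
      rw [hk₀, indicator_of_mem hz, abs_of_nonneg (by
        have : 0 < Ω z := by linarith
        positivity)]
      exact mul_le_mul h₂.le (Real.rpow_le_rpow_of_nonpos (by norm_num) (hnorm z hz).1 hexp)
        (by positivity) (by positivity)
    · rw [hk₀, indicator_of_notMem hz, abs_zero]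
      positivity
  set N : ℝ := (2 * n + 1) / δ with hN
  have hN0 : 0 < N := by positivity
  refine ⟨N • w, Ω w / 2 * (3 / 2) ^ (α - n) * N ^ (α - n), by positivity, fun x₀ ρ hρ => ?_⟩
  have hNρ : 0 < N * ρ := by positivity
  refine ⟨fun z => (N * ρ) ^ (α - n) * k₀ ((N * ρ)⁻¹ • z),
    (N * ρ) ^ (α - n) * (2 * Ω w * (1 / 2) ^ (α - n)),
    (hk₀m.comp (measurable_const_smul _)).const_mul _, fun z => ?_, fun x hx y hy => ?_⟩
  · rw [abs_mul, abs_of_nonneg (by positivity)]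
    gcongr
    exact hk₀B _
  · set u := (N * ρ)⁻¹ • (x - y) with hu
    have hxy : x - y = (N * ρ) • u := by rw [hu, smul_inv_smul₀ hNρ.ne']
    have hub : u ∈ ball w δ := by
      have hy' : y + (N * ρ) • w ∈ cube x₀ ρ := fun i => by
        have := hy i
        simp only [PiLp.sub_apply, PiLp.smul_apply, PiLp.add_apply, smul_eq_mul] at this ⊢
        convert this using 2
        ring
      have h₁ := cube_subset_closedBall _ (by linarith) (mem_cube_add (mem_cube_comm.1 hy') hx)
      rw [mem_closedBall_iff_norm, ← sub_sub, hxy, ← smul_sub, norm_smul, Real.norm_eq_abs,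
        abs_of_pos hNρ] at h₁
      rw [mem_ball_iff_norm]
      refine lt_of_mul_lt_mul_left (h₁.trans_lt ?_) hNρ.le
      rw [hN, mul_right_comm, div_mul_cancel₀ _ hδ.ne']
      linarith
    obtain ⟨-, h₁, -⟩ := hsub u hub
    obtain ⟨h₂, h₃⟩ := hnorm u hub
    have hu0 : u ≠ 0 := norm_pos_iff.1 (by linarith)
    have hku : k₀ u = Ω u * ‖u‖ ^ (α - n) := by rw [hk₀, indicator_of_mem hub]
    refine ⟨?_, ?_⟩
    · change _ = (N * ρ) ^ (α - n) * k₀ u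
      rw [hku, hxy, hhom _ hNρ u hu0, norm_smul, Real.norm_eq_abs, abs_of_pos hNρ,
        Real.mul_rpow hNρ.le (norm_nonneg u)]
      ring
    · change _ ≤ (N * ρ) ^ (α - n) * k₀ u
      rw [hku, Real.mul_rpow hN0.le hρ.le]
      have h₄ : (3 / 2 : ℝ) ^ (α - n) ≤ ‖u‖ ^ (α - n) :=
        Real.rpow_le_rpow_of_nonpos (by linarith) h₃ hexp
      have h₅ : 0 < Ω u := by linarith
      calc _ = N ^ (α - n) * ρ ^ (α - n) * (Ω w / 2 * (3 / 2) ^ (α - n)) := by ring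
        _ ≤ _ := by gcongr

/-- The mean oscillation over a cube is controlled by the deviation from any constant. -/
lemma lintegral_sub_setAvg_le {b : EuclideanSpace ℝ (Fin n) → ℝ} {x : EuclideanSpace ℝ (Fin n)}
    {ρ : ℝ} (hρ : 0 < ρ) (hb : IntegrableOn b (cube x ρ) volume) (m : ℝ) :
    ∫⁻ y in cube x ρ, ENNReal.ofReal |b y - setAvg (cube x ρ) b| ≤
      2 * ∫⁻ y in cube x ρ, ENNReal.ofReal |b y - m| := by
  have := isFiniteMeasure_restrict_cube x hρ.le
  have hV0 : volume (cube x ρ) ≠ 0 := by rw [volume_cube x hρ.le]; simpa using pow_pos hρ n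
  have hV : volume (cube x ρ) ≠ ∞ := by rw [volume_cube x hρ.le]; exact ofReal_ne_top
  have hVr : (volume (cube x ρ)).toReal ≠ 0 := (ENNReal.toReal_pos hV0 hV).ne'
  have havg : setAvg (cube x ρ) b - m =
      (volume (cube x ρ)).toReal⁻¹ * ∫ y in cube x ρ, (b y - m) := by
    rw [integral_sub hb (integrable_const m), integral_const, setAvg,
      measureReal_restrict_apply_univ,
      measureReal_def, smul_eq_mul]
    field_simp
  have hconst : ENNReal.ofReal |setAvg (cube x ρ) b - m| ≤
      (volume (cube x ρ))⁻¹ * ∫⁻ y in cube x ρ, ENNReal.ofReal |b y - m| := by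
    rw [havg, abs_mul, ENNReal.ofReal_mul (abs_nonneg _), abs_of_nonneg (by positivity),
      ENNReal.ofReal_inv_of_pos (ENNReal.toReal_pos hV0 hV), ENNReal.ofReal_toReal hV]
    gcongr
    simpa only [Real.enorm_eq_ofReal_abs] using
      enorm_integral_le_lintegral_enorm (μ := volume.restrict (cube x ρ)) fun y => b y - m
  calc ∫⁻ y in cube x ρ, ENNReal.ofReal |b y - setAvg (cube x ρ) b|
      ≤ ∫⁻ y in cube x ρ, (ENNReal.ofReal |b y - m| +
          ENNReal.ofReal |setAvg (cube x ρ) b - m|) := by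
        refine lintegral_mono fun y => ?_
        rw [← ENNReal.ofReal_add (abs_nonneg _) (abs_nonneg _)]
        refine ENNReal.ofReal_le_ofReal ?_
        rw [abs_sub_comm (setAvg _ _)]
        exact abs_sub_le _ _ _
    _ = (∫⁻ y in cube x ρ, ENNReal.ofReal |b y - m|) +
          ENNReal.ofReal |setAvg (cube x ρ) b - m| * volume (cube x ρ) := by
        rw [lintegral_add_right _ measurable_const, setLIntegral_const]
    _ ≤ _ := by
        rw [two_mul]
        gcongr
        refine (mul_le_mul_left hconst _).trans_eq ?_
        rw [mul_comm, ← mul_assoc, ENNReal.mul_inv_cancel hV0 hV, one_mul]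

/-- Boundedness of `[b, T_{Ω,α}]` from `(E_p^q)_t` to `(E_r^s)_t` with constant `C₀`. -/
def CommutatorBound {n : ℕ} (Ω : EuclideanSpace ℝ (Fin n) → ℝ) (α p q r s t C₀ : ℝ)
    (b : EuclideanSpace ℝ (Fin n) → ℝ) : Prop :=
  ∀ f : EuclideanSpace ℝ (Fin n) → ℝ, MemSlice p q t f →
    sliceNorm r s t (commutatorOp Ω α b f) ≤ ENNReal.ofReal C₀ * sliceNorm p q t f

/-- Testing a bounded commutator on the indicator function of a subset of a cube. -/
lemma CommutatorBound.lintegral_cube_le {Ω b G : EuclideanSpace ℝ (Fin n) → ℝ}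
    {α p q r s t C₀ : ℝ} (hn : 1 ≤ n) (hp1 : 1 < p) (hpr : p < r) (hq1 : 1 < q) (hqs : q < s)
    (hpr' : α / n = 1 / p - 1 / r) (hqs' : α / n = 1 / q - 1 / s) (ht : 0 < t) (hC₀ : 0 ≤ C₀)
    (hbd : CommutatorBound Ω α p q r s t C₀ b) {ρ : ℝ} (hρ : 0 < ρ)
    (x₀ z : EuclideanSpace ℝ (Fin n)) {E : Set (EuclideanSpace ℝ (Fin n))}
    (hE : MeasurableSet E) (hEz : E ⊆ cube z ρ) (hG : Measurable G)
    (hGeq : ∀ x ∈ cube x₀ ρ, commutatorOp Ω α b (E.indicator 1) x = G x) :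
    ∫⁻ x in cube x₀ ρ, ENNReal.ofReal |G x| ≤ ENNReal.ofReal (C₀ * (2 * ρ) ^ (n + α)) := by
  have hn0 : (0 : ℝ) < n := by exact_mod_cast hn
  have hp0 : 0 < p := by linarith
  have hq0 : 0 < q := by linarith
  have hr := Real.HolderConjugate.conjExponent (hp1.trans hpr)
  have hs := Real.HolderConjugate.conjExponent (hq1.trans hqs)
  set r' := r.conjExponent
  set s' := s.conjExponent
  set M := max ρ t with hM
  have hM0 : 0 < M := lt_max_of_lt_left hρ
  have h₁ : sliceNorm p q t (E.indicator 1) ≤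
      ENNReal.ofReal ((ρ / M) ^ (n / p) * (2 * M) ^ (n / q)) := by
    refine sliceNormE_le_of_le_indicator_cube hp0 hq0 ht hρ z fun y => ?_
    by_cases hy : y ∈ E
    · simp [hy, hEz hy]
    · simp [hy]
  have h₂ : sliceNormE r' s' t ((cube x₀ ρ).indicator 1) ≤
      ENNReal.ofReal ((ρ / M) ^ (n / r') * (2 * M) ^ (n / s')) :=
    sliceNormE_le_of_le_indicator_cube hr.symm.pos hs.symm.pos ht hρ x₀ fun y => le_rfl
  have hmem : MemSlice p q t (E.indicator 1) :=
    ⟨measurable_one.indicator hE, (h₁.trans_lt ofReal_lt_top).ne⟩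
  have h₃ : sliceNormE r s t ((cube x₀ ρ).indicator fun x => ENNReal.ofReal |G x|) ≤
      sliceNorm r s t (commutatorOp Ω α b (E.indicator 1)) := by
    refine sliceNormE_mono (by linarith) (by linarith) fun x => ?_
    by_cases hx : x ∈ cube x₀ ρ
    · simp [hx, hGeq x hx]
    · simp [hx]
  have hexp : ∀ {a c c' : ℝ}, c.HolderConjugate c' → α / n = 1 / a - 1 / c →
      (n : ℝ) / a + n / c' = n + α := by
    intro a c c' hc ha
    have h := hc.inv_add_inv_eq_one
    have hα : α = n * (a⁻¹ - c⁻¹) := by rw [← one_div, ← one_div, ← ha]; field_simp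
    simp only [div_eq_mul_inv]
    linear_combination (n : ℝ) * h - hα
  calc ∫⁻ x in cube x₀ ρ, ENNReal.ofReal |G x|
      = ∫⁻ x, (cube x₀ ρ).indicator (fun x => ENNReal.ofReal |G x|) x *
          (cube x₀ ρ).indicator 1 x := by
        rw [← lintegral_indicator (measurableSet_cube x₀ ρ)]
        refine lintegral_congr fun x => ?_
        by_cases hx : x ∈ cube x₀ ρ <;> simp [hx]
    _ ≤ _ := lintegral_mul_le_sliceNormE ht hr hs
        (hG.abs.ennreal_ofReal.indicator (measurableSet_cube x₀ ρ))
        (measurable_one.indicator (measurableSet_cube x₀ ρ))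
    _ ≤ ENNReal.ofReal C₀ * ENNReal.ofReal ((ρ / M) ^ (n / p) * (2 * M) ^ (n / q)) *
          ENNReal.ofReal ((ρ / M) ^ (n / r') * (2 * M) ^ (n / s')) := by
        refine mul_le_mul' (h₃.trans ((hbd _ hmem).trans ?_)) h₂
        gcongr
    _ = ENNReal.ofReal (C₀ * (2 * ρ) ^ (n + α)) := by
        rw [← ENNReal.ofReal_mul hC₀, ← ENNReal.ofReal_mul (by positivity), mul_assoc,
          mul_mul_mul_comm, ← Real.rpow_add (by positivity), ← Real.rpow_add (by positivity),
          hexp hr hpr', hexp hs hqs', ← Real.mul_rpow (by positivity) (by positivity)]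
        congr 3
        field_simp

/-- The commutator applied to the parts of a cube below and above a median of `b` controls the
deviation of `b` from that median. -/
lemma exists_median_abs_sub_le {Ω k b : EuclideanSpace ℝ (Fin n) → ℝ} {α B κ ρ : ℝ}
    (hρ : 0 < ρ) (hκ : 0 < κ) (hk : Measurable k) (hB : ∀ z, |k z| ≤ B) (hbm : Measurable b)
    (hb : LocallyIntegrable b volume) (x₀ z : EuclideanSpace ℝ (Fin n))
    (hker : ∀ x ∈ cube x₀ ρ, ∀ y ∈ cube z ρ,
      Ω (x - y) * ‖x - y‖ ^ (α - n) = k (x - y) ∧ κ ≤ k (x - y)) :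
    ∃ (m : ℝ) (E₁ E₂ : Set (EuclideanSpace ℝ (Fin n))), MeasurableSet E₁ ∧ MeasurableSet E₂ ∧
      E₁ ⊆ cube z ρ ∧ E₂ ⊆ cube z ρ ∧
      ∀ x ∈ cube x₀ ρ, κ * ρ ^ n / 2 * |b x - m| ≤
        |commutatorOp Ω α b (E₁.indicator 1) x| + |commutatorOp Ω α b (E₂.indicator 1) x| := by
  have := isFiniteMeasure_restrict_cube z hρ.le
  have hVfin : volume (cube z ρ) ≠ ∞ := by rw [volume_cube z hρ.le]; exact ofReal_ne_top
  have hV : volume.real (cube z ρ) = ρ ^ n := by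
    rw [measureReal_def, volume_cube z hρ.le, ENNReal.toReal_ofReal (by positivity)]
  obtain ⟨m, hm₁, hm₂⟩ := exists_median ((volume.restrict (cube z ρ)).map b)
  have hS₁ : MeasurableSet (b ⁻¹' Iic m) := hbm measurableSet_Iic
  have hS₂ : MeasurableSet (b ⁻¹' Ici m) := hbm measurableSet_Ici
  rw [Measure.map_apply hbm MeasurableSet.univ, Measure.map_apply hbm measurableSet_Iic,
    preimage_univ, Measure.restrict_apply_univ, Measure.restrict_apply hS₁] at hm₁
  rw [Measure.map_apply hbm MeasurableSet.univ, Measure.map_apply hbm measurableSet_Ici,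
    preimage_univ, Measure.restrict_apply_univ, Measure.restrict_apply hS₂] at hm₂
  have hreal : ∀ {S : Set (EuclideanSpace ℝ (Fin n))}, S ⊆ cube z ρ →
      volume (cube z ρ) ≤ 2 * volume S → ρ ^ n / 2 ≤ volume.real S := by
    intro S hS h
    have hSfin : volume S ≠ ∞ := (measure_mono hS |>.trans_lt hVfin.lt_top).ne
    have := ENNReal.toReal_mono (ENNReal.mul_ne_top ENNReal.ofNat_ne_top hSfin) h
    rw [ENNReal.toReal_mul, ← measureReal_def, hV, ← measureReal_def] at this
    simp only [ENNReal.toReal_ofNat] at this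
    linarith
  have hcomm : ∀ {S : Set (EuclideanSpace ℝ (Fin n))}, MeasurableSet S → S ⊆ cube z ρ →
      ∀ x ∈ cube x₀ ρ, IntegrableOn (fun y => k (x - y) * (b x - b y)) S volume ∧
        commutatorOp Ω α b (S.indicator 1) x = ∫ y in S, k (x - y) * (b x - b y) :=
    fun hS hSz x hx => commutatorOp_indicator hk hB hS
      (measure_mono hSz |>.trans_lt hVfin.lt_top).ne
      ((integrableOn_cube hb z hρ.le).mono_set hSz) fun y hy => (hker x hx y (hSz hy)).1
  refine ⟨m, b ⁻¹' Iic m ∩ cube z ρ, b ⁻¹' Ici m ∩ cube z ρ,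
    hS₁.inter (measurableSet_cube z ρ), hS₂.inter (measurableSet_cube z ρ),
    inter_subset_right, inter_subset_right, fun x hx => ?_⟩
  rcases le_total m (b x) with h | h
  · set S := b ⁻¹' Iic m ∩ cube z ρ with hS
    obtain ⟨hi, he⟩ := hcomm (hS₁.inter (measurableSet_cube z ρ)) inter_subset_right x hx
    have hle : ∫ _y in S, κ * (b x - m) ≤ ∫ y in S, k (x - y) * (b x - b y) := by
      refine setIntegral_mono_on (integrableOn_const
        (measure_mono inter_subset_right |>.trans_lt hVfin.lt_top).ne) hi
        (hS₁.inter (measurableSet_cube z ρ)) fun y hy => ?_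
      have h₁ : b y ≤ m := hy.1
      have h₂ := (hker x hx y hy.2).2
      exact mul_le_mul h₂ (by linarith) (by linarith) (hκ.le.trans h₂)
    rw [setIntegral_const, smul_eq_mul, ← he] at hle
    have hvol := hreal (S := S) inter_subset_right hm₁
    have h₃ : ρ ^ n / 2 * (κ * (b x - m)) ≤ volume.real S * (κ * (b x - m)) := by
      refine mul_le_mul_of_nonneg_right hvol (mul_nonneg hκ.le (by linarith))
    rw [abs_of_nonneg (by linarith : 0 ≤ b x - m)]
    linarith [le_abs_self (commutatorOp Ω α b (S.indicator 1) x),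
      abs_nonneg (commutatorOp Ω α b ((b ⁻¹' Ici m ∩ cube z ρ).indicator 1) x)]
  · set S := b ⁻¹' Ici m ∩ cube z ρ with hS
    obtain ⟨hi, he⟩ := hcomm (hS₂.inter (measurableSet_cube z ρ)) inter_subset_right x hx
    have hle : ∫ y in S, k (x - y) * (b x - b y) ≤ ∫ _y in S, κ * (b x - m) := by
      refine setIntegral_mono_on hi (integrableOn_const
        (measure_mono inter_subset_right |>.trans_lt hVfin.lt_top).ne)
        (hS₂.inter (measurableSet_cube z ρ)) fun y hy => ?_
      have h₁ : m ≤ b y := hy.1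
      have h₂ := (hker x hx y hy.2).2
      nlinarith
    rw [setIntegral_const, smul_eq_mul, ← he] at hle
    have hvol := hreal (S := S) inter_subset_right hm₂
    have h₃ : ρ ^ n / 2 * (κ * (m - b x)) ≤ volume.real S * (κ * (m - b x)) := by
      refine mul_le_mul_of_nonneg_right hvol (mul_nonneg hκ.le (by linarith))
    rw [abs_of_nonpos (by linarith : b x - m ≤ 0)]
    linarith [neg_le_abs (commutatorOp Ω α b (S.indicator 1) x),
      abs_nonneg (commutatorOp Ω α b ((b ⁻¹' Iic m ∩ cube z ρ).indicator 1) x)]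

lemma CommutatorBound.exists_lintegral_sub_le {Ω k b : EuclideanSpace ℝ (Fin n) → ℝ}
    {α p q r s t C₀ B c ρ : ℝ} (hn : 1 ≤ n) (hp1 : 1 < p) (hpr : p < r) (hq1 : 1 < q)
    (hqs : q < s) (hpr' : α / n = 1 / p - 1 / r) (hqs' : α / n = 1 / q - 1 / s) (ht : 0 < t)
    (hC₀ : 0 ≤ C₀) (hbd : CommutatorBound Ω α p q r s t C₀ b) (hρ : 0 < ρ) (hc : 0 < c)
    (hk : Measurable k) (hB : ∀ z, |k z| ≤ B) (hbm : Measurable b)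
    (hb : LocallyIntegrable b volume) (x₀ z : EuclideanSpace ℝ (Fin n))
    (hker : ∀ x ∈ cube x₀ ρ, ∀ y ∈ cube z ρ,
      Ω (x - y) * ‖x - y‖ ^ (α - n) = k (x - y) ∧ c * ρ ^ (α - n) ≤ k (x - y)) :
    ∃ m : ℝ, ∫⁻ x in cube x₀ ρ, ENNReal.ofReal |b x - m| ≤
      ENNReal.ofReal (4 * 2 ^ (n + α) / c * C₀ * ρ ^ n) := by
  obtain ⟨m, E₁, E₂, hE₁, hE₂, hEz₁, hEz₂, hm⟩ := exists_median_abs_sub_le hρ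
    (mul_pos hc (Real.rpow_pos_of_pos hρ (α - n))) hk hB hbm hb x₀ z hker
  refine ⟨m, ?_⟩
  have hGm : ∀ E : Set (EuclideanSpace ℝ (Fin n)),
      Measurable fun x => ∫ y in E, k (x - y) * (b x - b y) := by
    intro E
    have hm₂ : Measurable (Function.uncurry fun x y => k (x - y) * (b x - b y)) :=
      (hk.comp (measurable_fst.sub measurable_snd)).mul
        ((hbm.comp measurable_fst).sub (hbm.comp measurable_snd))
    exact (hm₂.stronglyMeasurable.integral_prod_right (ν := volume.restrict E)).measurable
  have hVfin : volume (cube z ρ) ≠ ∞ := by rw [volume_cube z hρ.le]; exact ofReal_ne_top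
  have hGeq : ∀ {E : Set (EuclideanSpace ℝ (Fin n))}, MeasurableSet E → E ⊆ cube z ρ →
      ∀ x ∈ cube x₀ ρ, commutatorOp Ω α b (E.indicator 1) x =
        ∫ y in E, k (x - y) * (b x - b y) :=
    fun hE hEz x hx => (commutatorOp_indicator hk hB hE
      (measure_mono hEz |>.trans_lt hVfin.lt_top).ne
      ((integrableOn_cube hb z hρ.le).mono_set hEz) fun y hy => (hker x hx y (hEz hy)).1).2
  have hint : ∀ {E : Set (EuclideanSpace ℝ (Fin n))}, MeasurableSet E → E ⊆ cube z ρ →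
      ∫⁻ x in cube x₀ ρ, ENNReal.ofReal |∫ y in E, k (x - y) * (b x - b y)| ≤
        ENNReal.ofReal (C₀ * (2 * ρ) ^ (n + α)) := fun hE hEz =>
    hbd.lintegral_cube_le hn hp1 hpr hq1 hqs hpr' hqs' ht hC₀ hρ x₀ z hE hEz (hGm _)
      (hGeq hE hEz)
  set A := c * ρ ^ (α - n) * ρ ^ n / 2 with hA
  have hA0 : 0 < A := by positivity
  have hle : ENNReal.ofReal A * ∫⁻ x in cube x₀ ρ, ENNReal.ofReal |b x - m| ≤
      ENNReal.ofReal (2 * (C₀ * (2 * ρ) ^ (n + α))) := by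
    rw [← lintegral_const_mul _ (hbm.sub_const m).abs.ennreal_ofReal, two_mul,
      ENNReal.ofReal_add (by positivity) (by positivity)]
    refine le_trans ?_ (add_le_add (hint hE₁ hEz₁) (hint hE₂ hEz₂))
    rw [← lintegral_add_left (hGm E₁).abs.ennreal_ofReal]
    refine setLIntegral_mono ((hGm E₁).abs.ennreal_ofReal.add (hGm E₂).abs.ennreal_ofReal)
      fun x hx => ?_
    rw [← ENNReal.ofReal_mul hA0.le, ← ENNReal.ofReal_add (abs_nonneg _) (abs_nonneg _),
      ← hGeq hE₁ hEz₁ x hx, ← hGeq hE₂ hEz₂ x hx]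
    exact ENNReal.ofReal_le_ofReal (hm x hx)
  have hA' : ENNReal.ofReal A ≠ 0 := by simpa using hA0
  rw [mul_comm, ← ENNReal.le_div_iff_mul_le (Or.inl hA') (Or.inl ofReal_ne_top),
    ← ENNReal.ofReal_div_of_pos hA0] at hle
  refine hle.trans_eq ?_
  congr 1
  rw [hA, Real.mul_rpow (by norm_num) hρ.le, Real.rpow_sub hρ, Real.rpow_add hρ,
    Real.rpow_natCast]
  have : ρ ^ α ≠ 0 := (Real.rpow_pos_of_pos hρ α).ne'
  field_simp
  ring

lemma setAvg_congr_ae {b b' : EuclideanSpace ℝ (Fin n) → ℝ} (h : b =ᵐ[volume] b')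
    (Q : Set (EuclideanSpace ℝ (Fin n))) : setAvg Q b = setAvg Q b' := by
  rw [setAvg, setAvg, integral_congr_ae (ae_restrict_of_ae h)]

lemma bmoNorm_congr_ae {b b' : EuclideanSpace ℝ (Fin n) → ℝ} (h : b =ᵐ[volume] b') :
    bmoNorm b = bmoNorm b' := by
  unfold bmoNorm
  refine iSup_congr fun x => iSup_congr fun ρ => iSup_congr fun _ => congrArg _ ?_
  rw [setAvg_congr_ae h]
  refine lintegral_congr_ae (ae_restrict_of_ae ?_)
  filter_upwards [h] with y hy
  rw [hy]

lemma CommutatorBound.congr_ae {Ω b b' : EuclideanSpace ℝ (Fin n) → ℝ} {α p q r s t C₀ : ℝ}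
    (hbd : CommutatorBound Ω α p q r s t C₀ b) (h : b =ᵐ[volume] b') :
    CommutatorBound Ω α p q r s t C₀ b' := by
  intro f hf
  have hfrac : fracInt Ω α (fun y => b y * f y) = fracInt Ω α fun y => b' y * f y := by
    funext x
    refine integral_congr_ae ?_
    filter_upwards [h] with y hy
    rw [hy]
  have hcomm : commutatorOp Ω α b f =ᵐ[volume] commutatorOp Ω α b' f := by
    filter_upwards [h] with x hx
    rw [commutatorOp, commutatorOp, hfrac, hx]
  have hnorm : sliceNorm r s t (commutatorOp Ω α b' f) =
      sliceNorm r s t (commutatorOp Ω α b f) := by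
    unfold sliceNorm sliceNormE
    congr 1
    refine lintegral_congr fun x => ?_
    congr 2
    refine lintegral_congr_ae (ae_restrict_of_ae ?_)
    filter_upwards [hcomm] with y hy
    rw [hy]
  rw [hnorm]
  exact hbd f hf

lemma CommutatorBound.neg_kernel {Ω b : EuclideanSpace ℝ (Fin n) → ℝ} {α p q r s t C₀ : ℝ}
    (hbd : CommutatorBound Ω α p q r s t C₀ b) :
    CommutatorBound (fun x => -Ω x) α p q r s t C₀ b := by
  have hfrac : ∀ f x, fracInt (fun x => -Ω x) α f x = -fracInt Ω α f x := by
    intro f x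
    simp only [fracInt, neg_mul, integral_neg]
  intro f hf
  have hnorm : sliceNorm r s t (commutatorOp (fun x => -Ω x) α b f) =
      sliceNorm r s t (commutatorOp Ω α b f) := by
    unfold sliceNorm
    congr 1
    funext x
    rw [commutatorOp, commutatorOp, hfrac, hfrac, ← abs_neg]
    ring_nf
  rw [hnorm]
  exact hbd f hf

/-- Necessity of `BMO` for boundedness of the commutator on slice spaces, for kernels which are
continuous and positive near some point of the unit sphere. -/
theorem exists_bmoNorm_le_of_commutatorBound (hn : 1 ≤ n) {α : ℝ} (hαn : α < n)
    {p q r s t : ℝ} (hp1 : 1 < p) (hpr : p < r) (hq1 : 1 < q) (hqs : q < s)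
    (hpr' : α / n = 1 / p - 1 / r) (hqs' : α / n = 1 / q - 1 / s) (ht : 0 < t)
    {Ω : EuclideanSpace ℝ (Fin n) → ℝ} (hhom : HomogZero Ω)
    {U : Set (EuclideanSpace ℝ (Fin n))} (hU : IsOpen U) (hΩ : ContinuousOn Ω U)
    {w : EuclideanSpace ℝ (Fin n)} (hwU : w ∈ U) (hw : ‖w‖ = 1) (hpos : 0 < Ω w) :
    ∃ C > (0 : ℝ), ∀ (b : EuclideanSpace ℝ (Fin n) → ℝ) (C₀ : ℝ), 0 ≤ C₀ →
      LocallyIntegrable b volume → CommutatorBound Ω α p q r s t C₀ b →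
      bmoNorm b ≤ ENNReal.ofReal (C * C₀) := by
  obtain ⟨v, c, hc, hker⟩ := exists_bounded_kernel hhom hαn hU hΩ hwU hw hpos
  refine ⟨2 * (4 * 2 ^ (n + α) / c), by positivity, fun b C₀ hC₀ hb hbd => ?_⟩
  have hae : b =ᵐ[volume] hb.aestronglyMeasurable.mk b := hb.aestronglyMeasurable.ae_eq_mk
  set b' := hb.aestronglyMeasurable.mk b
  have hbm : Measurable b' := hb.aestronglyMeasurable.stronglyMeasurable_mk.measurable
  have hb' : LocallyIntegrable b' volume := fun x =>
    (hb x).imp fun S hS => ⟨hS.1, hS.2.congr (ae_restrict_of_ae hae)⟩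
  rw [bmoNorm_congr_ae hae]
  refine iSup_le fun x₀ => iSup_le fun ρ => iSup_le fun hρ => ?_
  obtain ⟨k, B, hk, hB, hkρ⟩ := hker x₀ ρ hρ
  obtain ⟨m, hm⟩ := (hbd.congr_ae hae).exists_lintegral_sub_le hn hp1 hpr hq1 hqs hpr' hqs' ht
    hC₀ hρ hc hk hB hbm hb' x₀ _ hkρ
  have hρn : 0 < ρ ^ n := pow_pos hρ n
  rw [volume_cube x₀ hρ.le, ← ENNReal.ofReal_inv_of_pos hρn]
  calc _ ≤ ENNReal.ofReal (ρ ^ n)⁻¹ *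
        (2 * ENNReal.ofReal (4 * 2 ^ (n + α) / c * C₀ * ρ ^ n)) := by
        gcongr
        refine (lintegral_sub_setAvg_le hρ (integrableOn_cube hb' x₀ hρ.le) m).trans ?_
        gcongr
    _ = ENNReal.ofReal (2 * (4 * 2 ^ (n + α) / c) * C₀) := by
        rw [← ENNReal.ofReal_ofNat, ← ENNReal.ofReal_mul (by norm_num),
          ← ENNReal.ofReal_mul (by positivity)]
        congr 1
        field_simp

end

theorem statement1 (n : ℕ) (hn : 1 ≤ n) (α : ℝ) (hα0 : 0 < α) (hαn : α < n)
    (p q r s : ℝ) (hp1 : 1 < p) (hpr : p < r) (hq1 : 1 < q) (hqs : q < s)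
    (hpr' : α / n = 1 / p - 1 / r) (hqs' : α / n = 1 / q - 1 / s)
    (Ω : EuclideanSpace ℝ (Fin n) → ℝ) (hhom : HomogZero Ω) (hmean : MeanZeroOnSphere Ω)
    (U : Set (EuclideanSpace ℝ (Fin n))) (hUopen : IsOpen U)
    (hUne : (U ∩ sphere (0 : EuclideanSpace ℝ (Fin n)) 1).Nonempty)
    (hsmooth : ContDiffOn ℝ (⊤ : ℕ∞) Ω U)
    (hnz : ∀ x ∈ U ∩ sphere (0 : EuclideanSpace ℝ (Fin n)) 1, Ω x ≠ 0)
    (t : ℝ) (ht : 0 < t) :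
    ∃ C > (0 : ℝ), ∀ (b : EuclideanSpace ℝ (Fin n) → ℝ) (C₀ : ℝ), 0 ≤ C₀ →
      LocallyIntegrable b volume →
      (∀ f : EuclideanSpace ℝ (Fin n) → ℝ, MemSlice p q t f →
        sliceNorm r s t (commutatorOp Ω α b f) ≤ ENNReal.ofReal C₀ * sliceNorm p q t f) →
      MemBMO b ∧ bmoNorm b ≤ ENNReal.ofReal (C * C₀) := by
  have main : ∃ C > (0 : ℝ), ∀ (b : EuclideanSpace ℝ (Fin n) → ℝ) (C₀ : ℝ), 0 ≤ C₀ →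
      LocallyIntegrable b volume → CommutatorBound Ω α p q r s t C₀ b →
      bmoNorm b ≤ ENNReal.ofReal (C * C₀) := by
    obtain ⟨w, hwU, hw⟩ := hUne
    have hw1 : ‖w‖ = 1 := mem_sphere_zero_iff_norm.1 hw
    rcases lt_or_gt_of_ne (hnz w ⟨hwU, hw⟩) with hneg | hpos
    · obtain ⟨C, hC, h⟩ := exists_bmoNorm_le_of_commutatorBound hn hαn hp1 hpr hq1 hqs hpr' hqs'
        ht (Ω := fun x => -Ω x) (fun l hl x hx => congrArg Neg.neg (hhom l hl x hx)) hUopen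
        hsmooth.continuousOn.neg hwU hw1 (neg_pos.2 hneg)
      exact ⟨C, hC, fun b C₀ hC₀ hb hbd => h b C₀ hC₀ hb hbd.neg_kernel⟩
    · exact exists_bmoNorm_le_of_commutatorBound hn hαn hp1 hpr hq1 hqs hpr' hqs' ht hhom hUopen
        hsmooth.continuousOn hwU hw1 hpos
  obtain ⟨C, hC, h⟩ := main
  refine ⟨C, hC, fun b C₀ hC₀ hb hbd => ?_⟩
  have hle := h b C₀ hC₀ hb hbd
  exact ⟨⟨hb, (hle.trans_lt ofReal_lt_top).ne⟩, hle⟩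

end
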